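/- arXiv:1106.2687 — 3 statements merged into one kernel-verified Lean document; each statement's English description precedes it below -/
import Mathlib

section
/- Let $\{\mathcal{F}_k\}_{0\le k\le N}$ be a filtration on a probability space, let $\{U_k\}_{1\le k\le N}$ be nonnegative $\mathcal{F}_N$-measurable random variables, and let $\{M_k\}_{0\le k\le N}$ be a martingale with respect to $\{\mathcal{F}_k\}$ whose increments $\Delta_k := M_k - M_{k-1}$ satisfy almost surely $|\Delta_k| \le c_0$ for some $c_0 > 0$ and $\mathbb{E}(\Delta_k^2 \mid \mathcal{F}_{k-1}) \le \mathbb{E}(U_k \mid \mathcal{F}_{k-1})$. Assume that for some constants $0 < c_1, c_2 < \infty$ and some $x_0 \ge e^2 c_0^2$ one has $\mathbb{P}(\sum_{k=1}^N U_k > x) \le c_1 \exp(-c_2 x)$ for all $x \ge x_0$. Then there exist universal constants $0 < c_3, c_4 < \infty$, not depending on $N$, $c_0$, $c_1$, $c_2$, $x_0$, nor on the distributions of $\{M_k\}$ and $\{U_k\}$, such that for every $x$ with $0 < x \le c_2 x_0^{3/2}$, $\mathbb{P}(M_N - M_0 \ge x) \le c_3 (1 + c_1 + c_1/(c_2 x_0))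 \exp(-c_4 x / \sqrt{x_0})$. -/
open MeasureTheory

section

variable {Ω : Type*} {m0 : MeasurableSpace Ω} {μ : Measure Ω}

lemma succ_mul_pow_mul_le {a b : ℝ} (ha : 0 ≤ a) (hb : 0 ≤ b) (q : ℕ) :
    (q + 1) * (a ^ q * b) ≤ q * a ^ (q + 1) + b ^ (q + 1) := by
  induction q with
  | zero => simp
  | succ q ih =>
    have h1 := mul_le_mul_of_nonneg_right ih hb
    have h2 : 0 ≤ ((q : ℝ) + 1) * a ^ q * (a - b) ^ 2 := by positivity
    push_cast
    ring_nf at h1 h2 ⊢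
    linarith

lemma Real.exp_le_one_add_add_sq {u : ℝ} (hu : |u| ≤ 1) : Real.exp u ≤ 1 + u + u ^ 2 := by
  linarith [(abs_le.mp (Real.abs_exp_sub_one_sub_id_le hu)).2]

lemma integral_mul_condExp_eq [IsFiniteMeasure μ] {m : MeasurableSpace Ω} (hm : m ≤ m0)
    {f g : Ω → ℝ} (hf : StronglyMeasurable[m] f) (hfg : Integrable (fun ω => f ω * g ω) μ)
    (hg : Integrable g μ) :
    Integrable (fun ω => f ω * (μ[g | m]) ω) μ ∧
      ∫ ω, f ω * (μ[g | m]) ω ∂μ = ∫ ω, f ω * g ω ∂μ := by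
  have h := condExp_mul_of_stronglyMeasurable_left hf hfg hg
  refine ⟨integrable_condExp.congr h, ?_⟩
  exact (integral_congr_ae h).symm.trans (integral_condExp hm)

lemma integrable_pow_mul {f g : Ω → ℝ} {q : ℕ} (hf : MemLp f (q + 1 : ℕ) μ)
    (hg : MemLp g (q + 1 : ℕ) μ) : Integrable (fun ω => f ω ^ q * g ω) μ := by
  have hf' := hf.integrable_norm_pow q.succ_ne_zero
  have hg' := hg.integrable_norm_pow q.succ_ne_zero
  refine ((hf'.const_mul (q : ℝ)).add hg').mono' ((hf.1.pow q).mul hg.1) (ae_of_all _ fun ω => ?_)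
  have h := succ_mul_pow_mul_le (norm_nonneg (f ω)) (norm_nonneg (g ω)) q
  have h' : 0 ≤ (q : ℝ) * (‖f ω‖ ^ q * ‖g ω‖) := by positivity
  simp only [norm_mul, norm_pow, Pi.add_apply]
  linarith

/-- The moments of a sum of predictable projections are controlled by those of the sum itself. -/
lemma integral_sum_condExp_pow_le [IsProbabilityMeasure μ] (ℱ : Filtration ℕ m0) {U : ℕ → Ω → ℝ}
    {N q : ℕ} (hU0 : ∀ k < N, 0 ≤ᵐ[μ] U k) (hU : ∀ k < N, MemLp (U k) (q + 1 : ℕ) μ) :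
    Integrable (fun ω => (∑ k ∈ Finset.range N, (μ[U k | ℱ k]) ω) ^ (q + 1)) μ ∧
    ∫ ω, (∑ k ∈ Finset.range N, (μ[U k | ℱ k]) ω) ^ (q + 1) ∂μ ≤
      (q + 1) ^ (q + 1) * ∫ ω, (∑ k ∈ Finset.range N, U k ω) ^ (q + 1) ∂μ := by
  set V : ℕ → Ω → ℝ := fun n ω => ∑ k ∈ Finset.range n, (μ[U k | ℱ k]) ω
  set W : Ω → ℝ := fun ω => ∑ k ∈ Finset.range N, U k ω
  have h1p : (1 : ENNReal) ≤ (q + 1 : ℕ) := by exact_mod_cast Nat.le_add_left 1 q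
  have hUi : ∀ k < N, Integrable (U k) μ := fun k hk => (hU k hk).integrable h1p
  have hvL : ∀ k < N, MemLp (μ[U k | ℱ k]) (q + 1 : ℕ) μ := fun k hk => (hU k hk).condExp h1p
  have hVL : ∀ n ≤ N, MemLp (V n) (q + 1 : ℕ) μ := fun n hn =>
    memLp_finsetSum _ fun k hk => hvL k ((Finset.mem_range.1 hk).trans_le hn)
  have hWL : MemLp W (q + 1 : ℕ) μ :=
    memLp_finsetSum _ fun k hk => hU k (Finset.mem_range.1 hk)
  have hVm : ∀ k, StronglyMeasurable[ℱ k] (V (k + 1)) := fun k =>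
    Finset.stronglyMeasurable_fun_sum _ fun i hi =>
      stronglyMeasurable_condExp.mono (ℱ.mono (Nat.lt_succ_iff.1 (Finset.mem_range.1 hi)))
  have hv0 : ∀ᵐ ω ∂μ, ∀ k < N, 0 ≤ (μ[U k | ℱ k]) ω :=
    ae_all_iff.2 fun k => Filter.eventually_imp_distrib_left.2 fun hk => condExp_nonneg (hU0 k hk)
  have hu0 : ∀ᵐ ω ∂μ, ∀ k < N, 0 ≤ U k ω :=
    ae_all_iff.2 fun k => Filter.eventually_imp_distrib_left.2 fun hk => hU0 k hk
  have hmono : ∀ ω, (∀ k < N, 0 ≤ (μ[U k | ℱ k]) ω) → ∀ n ≤ N, 0 ≤ V n ω ∧ V n ω ≤ V N ω :=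
    fun ω hω n hn => ⟨Finset.sum_nonneg fun k hk => hω k ((Finset.mem_range.1 hk).trans_le hn),
      Finset.sum_le_sum_of_subset_of_nonneg (Finset.range_subset_range.2 hn)
        fun k hk _ => hω k (Finset.mem_range.1 hk)⟩
  have hpow : ∀ n ≤ N, Integrable (fun ω => V n ω ^ (q + 1)) μ := fun n hn => by
    refine ((hVL n hn).integrable_norm_pow q.succ_ne_zero).mono' ((hVL n hn).1.pow _)
      (ae_of_all _ fun ω => (norm_pow _ _).le)
  have hWpow : Integrable (fun ω => W ω ^ (q + 1)) μ :=
    (hWL.integrable_norm_pow q.succ_ne_zero).mono' (hWL.1.pow _)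
      (ae_of_all _ fun ω => (norm_pow _ _).le)
  have hind : ∀ n ≤ N, ∫ ω, V n ω ^ (q + 1) ∂μ ≤
      (q + 1) * ∑ k ∈ Finset.range n, ∫ ω, V N ω ^ q * U k ω ∂μ := by
    intro n
    induction n with
    | zero => simp [V]
    | succ n ih =>
      intro hn
      have hn' : n < N := hn
      rw [Finset.sum_range_succ, mul_add]
      obtain ⟨hi, he⟩ := integral_mul_condExp_eq (f := fun ω => V (n + 1) ω ^ q) (ℱ.le n)
        ((hVm n).pow q)
        (integrable_pow_mul (hVL _ hn) (hU n hn')) (hUi n hn')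
      have h1 : ∫ ω, V (n + 1) ω ^ (q + 1) ∂μ ≤ ∫ ω, (V n ω ^ (q + 1) +
          (q + 1) * (V (n + 1) ω ^ q * (μ[U n | ℱ n]) ω)) ∂μ := by
        refine integral_mono_ae (hpow _ hn) ((hpow n hn'.le).add (hi.const_mul _)) ?_
        filter_upwards [hv0] with ω hω
        have := succ_mul_pow_mul_le (hmono ω hω _ hn).1 (hmono ω hω _ hn'.le).1 q
        have hs : V (n + 1) ω = V n ω + (μ[U n | ℱ n]) ω := Finset.sum_range_succ _ _
        have hs' : (μ[U n | ℱ n]) ω = V (n + 1) ω - V n ω := by linarith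
        simp only [hs']
        ring_nf at this ⊢
        linarith
      rw [integral_add (hpow n hn'.le) (hi.const_mul _), integral_const_mul, he] at h1
      refine h1.trans (add_le_add (ih hn'.le) (mul_le_mul_of_nonneg_left ?_ (by positivity)))
      refine integral_mono_ae (integrable_pow_mul (hVL _ hn) (hU n hn'))
        (integrable_pow_mul (hVL _ le_rfl) (hU n hn')) ?_
      filter_upwards [hv0, hu0] with ω hω hω'
      exact mul_le_mul_of_nonneg_right (pow_le_pow_left₀ (hmono ω hω _ hn).1
        (hmono ω hω _ hn).2 q) (hω' n hn')
  refine ⟨hpow N le_rfl, ?_⟩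
  have h2 := hind N le_rfl
  rw [← integral_finsetSum _ fun k hk =>
    integrable_pow_mul (hVL _ le_rfl) (hU k (Finset.mem_range.1 hk))] at h2
  have h3 : ∫ ω, (q + 1) * ∑ k ∈ Finset.range N, V N ω ^ q * U k ω ∂μ ≤
      ∫ ω, (q / (q + 1) * V N ω ^ (q + 1) + (q + 1) ^ q * W ω ^ (q + 1)) ∂μ := by
    refine integral_mono_ae (Integrable.const_mul (integrable_finsetSum _ fun k hk =>
      integrable_pow_mul (hVL _ le_rfl) (hU k (Finset.mem_range.1 hk))) _)
      (((hpow N le_rfl).const_mul _).add (hWpow.const_mul _)) ?_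
    filter_upwards [hv0, hu0] with ω hω hω'
    have hW0 : 0 ≤ W ω := Finset.sum_nonneg fun k hk => hω' k (Finset.mem_range.1 hk)
    have := succ_mul_pow_mul_le (hmono ω hω _ le_rfl).1
      (mul_nonneg (by positivity : (0 : ℝ) ≤ q + 1) hW0) q
    have hq : (0 : ℝ) < q + 1 := by positivity
    simp only [← Finset.mul_sum]
    change (q + 1) * (V N ω ^ q * W ω) ≤ _
    rw [← mul_le_mul_iff_right₀ hq]
    have e : ((q : ℝ) + 1) * (q / (q + 1) * V N ω ^ (q + 1) + (q + 1) ^ q * W ω ^ (q + 1)) =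
      q * V N ω ^ (q + 1) + ((q + 1) * W ω) ^ (q + 1) := by
      rw [mul_pow]
      field_simp
      ring
    rw [e]
    refine le_trans (le_of_eq ?_) this
    ring
  rw [integral_add ((hpow N le_rfl).const_mul _) (hWpow.const_mul _), integral_const_mul,
    integral_const_mul, integral_const_mul] at h3
  have h4 := h2.trans h3
  have hq : (0 : ℝ) < q + 1 := by positivity
  rw [← mul_le_mul_iff_right₀ hq] at h4
  have e : ((q : ℝ) + 1) * (q / (q + 1) * (∫ ω, V N ω ^ (q + 1) ∂μ)
      + (q + 1) ^ q * ∫ ω, W ω ^ (q + 1) ∂μ) =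
      q * (∫ ω, V N ω ^ (q + 1) ∂μ) + (q + 1) ^ (q + 1) * ∫ ω, W ω ^ (q + 1) ∂μ := by
    field_simp
    ring
  rw [e] at h4
  change ∫ ω, V N ω ^ (q + 1) ∂μ ≤ (q + 1) ^ (q + 1) * ∫ ω, W ω ^ (q + 1) ∂μ
  linarith

/-- The exponential supermartingale behind Freedman's inequality. -/
lemma integrable_exp_and_integral_exp_le_one [IsProbabilityMeasure μ] {ℱ : Filtration ℕ m0}
    {M v : ℕ → Ω → ℝ} {N : ℕ} {c l : ℝ} (hM : Martingale M ℱ μ)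
    (hb : ∀ k < N, ∀ᵐ ω ∂μ, |M (k + 1) ω - M k ω| ≤ c)
    (hvm : ∀ k, StronglyMeasurable[ℱ k] (v k)) (hv0 : ∀ k < N, 0 ≤ᵐ[μ] v k)
    (hv : ∀ k < N, μ[fun ω => (M (k + 1) ω - M k ω) ^ 2 | ℱ k] ≤ᵐ[μ] v k)
    (hl : 0 ≤ l) (hlc : l * c ≤ 1) {n : ℕ} (hn : n ≤ N) :
    Integrable (fun ω => Real.exp (l * (M n ω - M 0 ω) - l ^ 2 * ∑ k ∈ Finset.range n, v k ω)) μ ∧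
    ∫ ω, Real.exp (l * (M n ω - M 0 ω) - l ^ 2 * ∑ k ∈ Finset.range n, v k ω) ∂μ ≤ 1 := by
  set Z : ℕ → Ω → ℝ := fun n ω =>
    Real.exp (l * (M n ω - M 0 ω) - l ^ 2 * ∑ k ∈ Finset.range n, v k ω) with hZ
  have hZm : ∀ n, StronglyMeasurable[ℱ n] (Z n) := fun n => by
    refine Real.continuous_exp.comp_stronglyMeasurable (StronglyMeasurable.sub
      ((((hM.1 n).sub ((hM.1 0).mono (ℱ.mono n.zero_le)))).const_mul l)
      (StronglyMeasurable.const_mul ?_ _))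
    exact Finset.stronglyMeasurable_fun_sum _ fun i hi =>
      (hvm i).mono (ℱ.mono (Finset.mem_range.1 hi).le)
  have hv0' : ∀ᵐ ω ∂μ, ∀ k < N, 0 ≤ v k ω :=
    ae_all_iff.2 fun k => Filter.eventually_imp_distrib_left.2 fun hk => hv0 k hk
  have hb' : ∀ᵐ ω ∂μ, ∀ k < N, |M (k + 1) ω - M k ω| ≤ c :=
    ae_all_iff.2 fun k => Filter.eventually_imp_distrib_left.2 fun hk => hb k hk
  have hZb : ∀ n ≤ N, ∀ᵐ ω ∂μ, ‖Z n ω‖ ≤ Real.exp (l * (n * c)) := fun n hn => by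
    filter_upwards [hv0', hb'] with ω hω hω'
    rw [Real.norm_eq_abs, Real.abs_exp, Real.exp_le_exp]
    have h1 : M n ω - M 0 ω ≤ n * c := by
      rw [← Finset.sum_range_sub (fun k => M k ω) n]
      refine (Finset.sum_le_card_nsmul _ _ c fun k hk => (le_abs_self _).trans
        (hω' k ((Finset.mem_range.1 hk).trans_le hn))).trans_eq ?_
      simp
    have h2 : 0 ≤ ∑ k ∈ Finset.range n, v k ω :=
      Finset.sum_nonneg fun k hk => hω k ((Finset.mem_range.1 hk).trans_le hn)
    have h3 := mul_le_mul_of_nonneg_left h1 hl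
    have h4 := mul_nonneg (sq_nonneg l) h2
    linarith
  have hZi : ∀ n ≤ N, Integrable (Z n) μ := fun n hn =>
    (integrable_const _).mono' ((hZm n).mono (ℱ.le n)).aestronglyMeasurable (hZb n hn)
  refine ⟨hZi n hn, ?_⟩
  change ∫ ω, Z n ω ∂μ ≤ 1
  induction n with
  | zero => simp [hZ]
  | succ n ih =>
    have hn' : n < N := hn
    refine le_trans ?_ (ih hn'.le)
    set Y : Ω → ℝ := fun ω => Z n ω * Real.exp (-(l ^ 2 * v n ω)) with hY
    have hYm : StronglyMeasurable[ℱ n] Y :=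
      (hZm n).mul (Real.continuous_exp.comp_stronglyMeasurable ((hvm n).const_mul _).neg)
    have hY0 : ∀ ω, 0 ≤ Y ω := fun ω => by positivity
    have hYb : ∀ᵐ ω ∂μ, ‖Y ω‖ ≤ Real.exp (l * (n * c)) := by
      filter_upwards [hZb n hn'.le, hv0 n hn'] with ω hω hω'
      refine (norm_mul _ _).trans_le ((mul_le_of_le_one_right (norm_nonneg _) ?_).trans hω)
      rw [Real.norm_eq_abs, Real.abs_exp]
      exact Real.exp_le_one_iff.2 (neg_nonpos.2 (mul_nonneg (sq_nonneg l) hω'))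
    have hYmul : ∀ {f : Ω → ℝ}, Integrable f μ → Integrable (fun ω => Y ω * f ω) μ := fun hf =>
      hf.bdd_mul (hYm.mono (ℱ.le n)).aestronglyMeasurable hYb
    have hYi : Integrable Y μ := by simpa using hYmul (integrable_const 1)
    have hdi : Integrable (fun ω => M (n + 1) ω - M n ω) μ := (hM.integrable _).sub (hM.integrable _)
    have hd2i : Integrable (fun ω => (M (n + 1) ω - M n ω) ^ 2) μ := by
      refine (integrable_const (c ^ 2)).mono' (hdi.1.pow 2) ?_
      filter_upwards [hb n hn'] with ω hω
      rw [norm_pow]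
      exact pow_le_pow_left₀ (norm_nonneg _) hω 2
    have hd0 : μ[fun ω => M (n + 1) ω - M n ω | ℱ n] =ᵐ[μ] 0 := by
      have h1 := condExp_sub (hM.integrable (n + 1)) (hM.integrable n) (ℱ n)
      have h2 := hM.2 n (n + 1) n.le_succ
      have h3 := hM.2 n n le_rfl
      filter_upwards [h1, h2, h3] with ω e1 e2 e3
      refine e1.trans ?_
      simp [e2, e3]
    obtain ⟨-, he1⟩ := integral_mul_condExp_eq (ℱ.le n) hYm (hYmul hdi) hdi
    obtain ⟨hi2, he2⟩ := integral_mul_condExp_eq (ℱ.le n) hYm (hYmul hd2i) hd2i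
    have hz1 : ∫ ω, Y ω * (M (n + 1) ω - M n ω) ∂μ = 0 := by
      rw [← he1]
      refine integral_eq_zero_of_ae ?_
      filter_upwards [hd0] with ω hω
      simp [hω]
    have hsi : Integrable (fun ω => Y ω + l * (Y ω * (M (n + 1) ω - M n ω))) μ :=
      hYi.add ((hYmul hdi).const_mul l)
    calc ∫ ω, Z (n + 1) ω ∂μ
        ≤ ∫ ω, (Y ω + l * (Y ω * (M (n + 1) ω - M n ω))
            + l ^ 2 * (Y ω * (M (n + 1) ω - M n ω) ^ 2)) ∂μ := by
          refine integral_mono_ae (hZi _ hn) (hsi.add ((hYmul hd2i).const_mul _)) ?_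
          filter_upwards [hb n hn'] with ω hω
          have hu : |l * (M (n + 1) ω - M n ω)| ≤ 1 := by
            rw [abs_mul, abs_of_nonneg hl]
            exact (mul_le_mul_of_nonneg_left hω hl).trans hlc
          have h := mul_le_mul_of_nonneg_left (Real.exp_le_one_add_add_sq hu) (hY0 ω)
          have e : Z (n + 1) ω = Y ω * Real.exp (l * (M (n + 1) ω - M n ω)) := by
            simp only [hZ, hY, ← Real.exp_add, Finset.sum_range_succ]
            ring_nf
          rw [e]
          refine h.trans_eq ?_
          ring
      _ = ∫ ω, (Y ω + l ^ 2 * (Y ω * (μ[fun ω => (M (n + 1) ω - M n ω) ^ 2 | ℱ n]) ω)) ∂μ := by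
          rw [integral_add hsi ((hYmul hd2i).const_mul _),
            integral_add hYi ((hYmul hdi).const_mul l), integral_add hYi (hi2.const_mul _)]
          simp only [integral_const_mul, hz1, he2]
          ring
      _ ≤ ∫ ω, Z n ω ∂μ := by
          refine integral_mono_ae (hYi.add (hi2.const_mul _)) (hZi n hn'.le) ?_
          filter_upwards [hv n hn'] with ω hω
          have h1 : 1 + l ^ 2 * (μ[fun ω => (M (n + 1) ω - M n ω) ^ 2 | ℱ n]) ω ≤
              Real.exp (l ^ 2 * v n ω) := by
            have := Real.add_one_le_exp (l ^ 2 * v n ω)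
            have := mul_le_mul_of_nonneg_left hω (sq_nonneg l)
            linarith
          have h2 := mul_le_mul_of_nonneg_left h1 (hY0 ω)
          have e : Y ω * Real.exp (l ^ 2 * v n ω) = Z n ω := by
            rw [hY, mul_assoc, ← Real.exp_add]
            simp
          rw [e] at h2
          refine le_trans (le_of_eq ?_) h2
          ring

/-- An exponential tail beyond `x₀` bounds all moments. -/
lemma memLp_and_integral_pow_le_of_tail {W : Ω → ℝ} {c₁ c₂ x₀ : ℝ} [IsProbabilityMeasure μ]
    (hc₁ : 0 < c₁) (hc₂ : 0 < c₂) (hx₀ : 0 < x₀) (hW0 : 0 ≤ᵐ[μ] W) (hWm : AEMeasurable W μ)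
    (htail : ∀ x, x₀ ≤ x → μ {ω | x < W ω} ≤ ENNReal.ofReal (c₁ * Real.exp (-c₂ * x))) (q : ℕ) :
    MemLp W (q + 1 : ℕ) μ ∧ ∫ ω, W ω ^ (q + 1) ∂μ ≤
      x₀ ^ (q + 1) + c₁ * ((q + 1).factorial / c₂ ^ (q + 1)) := by
  have hlin : ∫⁻ ω, ENNReal.ofReal (W ω ^ (q + 1)) ∂μ ≤
      ENNReal.ofReal (x₀ ^ (q + 1) + c₁ * ((q + 1).factorial / c₂ ^ (q + 1))) := by
    have h := lintegral_rpow_eq_lintegral_meas_lt_mul μ hW0 hWm (p := (q : ℝ) + 1) (by positivity)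
    have hcast : ∀ t : ℝ, t ^ ((q : ℝ) + 1) = t ^ (q + 1) := fun t => by
      exact_mod_cast Real.rpow_natCast t (q + 1)
    simp only [hcast, add_sub_cancel_right, Real.rpow_natCast] at h
    rw [h]
    have hpt : ∀ t ∈ Set.Ioi (0 : ℝ), μ {a | t < W a} * ENNReal.ofReal (t ^ q) ≤
        (Set.Ioc 0 x₀).indicator (fun t => ENNReal.ofReal (t ^ q)) t +
          ENNReal.ofReal (c₁ * (t ^ q * Real.exp (-(c₂ * t)))) := by
      intro t ht
      have ht : 0 < t := ht
      rcases le_or_gt t x₀ with h | h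
      · rw [Set.indicator_of_mem (Set.mem_Ioc.2 ⟨ht, h⟩)]
        exact (mul_le_of_le_one_left' prob_le_one).trans le_self_add
      · rw [Set.indicator_of_notMem (fun h' => h.not_ge h'.2), zero_add]
        refine (mul_le_mul_left (htail t h.le) _).trans_eq ?_
        rw [← ENNReal.ofReal_mul (by positivity)]
        congr 1
        ring_nf
    have hI1 : ∫⁻ t in Set.Ioi (0 : ℝ),
        (Set.Ioc 0 x₀).indicator (fun t => ENNReal.ofReal (t ^ q)) t =
        ENNReal.ofReal (x₀ ^ (q + 1) / (q + 1)) := by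
      rw [setLIntegral_indicator measurableSet_Ioc,
        Set.inter_eq_left.2 (fun t ht => ht.1),
        ← ofReal_integral_eq_lintegral_ofReal]
      · rw [← intervalIntegral.integral_of_le hx₀.le, integral_pow]
        simp
      · exact ((continuous_pow q).integrableOn_Icc).mono_set Set.Ioc_subset_Icc_self
      · exact (ae_restrict_mem measurableSet_Ioc).mono fun t ht => pow_nonneg ht.1.le q
    have hG := Real.integral_rpow_mul_exp_neg_mul_Ioi (a := (q : ℝ) + 1) (by positivity) hc₂
    simp only [hcast, add_sub_cancel_right, Real.rpow_natCast, Real.Gamma_nat_eq_factorial] at hG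
    have hGi : IntegrableOn (fun t : ℝ => t ^ q * Real.exp (-(c₂ * t))) (Set.Ioi 0) := by
      refine Integrable.of_integral_ne_zero ?_
      rw [hG]
      positivity
    have hI2 : ∫⁻ t in Set.Ioi (0 : ℝ), ENNReal.ofReal (c₁ * (t ^ q * Real.exp (-(c₂ * t)))) =
        ENNReal.ofReal (c₁ * ((1 / c₂) ^ (q + 1) * q.factorial)) := by
      rw [← ofReal_integral_eq_lintegral_ofReal (hGi.const_mul _), integral_const_mul, hG]
      exact (ae_restrict_mem measurableSet_Ioi).mono fun t (ht : 0 < t) => by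
        simp only [Pi.zero_apply]; positivity
    refine (mul_le_mul_right (setLIntegral_mono' measurableSet_Ioi hpt) _).trans_eq ?_
    rw [lintegral_add_left ((by fun_prop : Measurable fun t : ℝ => ENNReal.ofReal
      (t ^ q)).indicator measurableSet_Ioc), hI1, hI2, ← ENNReal.ofReal_add (by positivity)
      (by positivity), ← ENNReal.ofReal_mul (by positivity)]
    congr 1
    rw [Nat.factorial_succ, one_div, inv_pow]
    push_cast
    field_simp
  have hint : Integrable (fun ω => W ω ^ (q + 1)) μ :=
    ⟨hWm.aestronglyMeasurable.pow _, (hasFiniteIntegral_iff_ofReal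
      (hW0.mono fun ω hω => pow_nonneg hω _)).2 (hlin.trans_lt ENNReal.ofReal_lt_top)⟩
  constructor
  · rw [← integrable_norm_rpow_iff hWm.aestronglyMeasurable (by simp) (by simp)]
    refine hint.congr (hW0.mono fun ω hω => ?_)
    simp only [ENNReal.toReal_natCast, Real.rpow_natCast, Real.norm_of_nonneg hω]
  · rw [integral_eq_lintegral_of_nonneg_ae (hW0.mono fun ω hω => pow_nonneg hω _) hint.1]
    exact ENNReal.toReal_le_of_le_ofReal (by positivity) hlin

/-- Tail of the sum of predictable projections, given an exponential tail of the sum. -/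
lemma measureReal_sum_condExp_le [IsProbabilityMeasure μ] (ℱ : Filtration ℕ m0) {U : ℕ → Ω → ℝ}
    {N : ℕ} {c₁ c₂ x₀ z : ℝ} (hc₁ : 0 < c₁) (hc₂ : 0 < c₂) (hx₀ : 0 < x₀)
    (hU0 : ∀ k < N, 0 ≤ᵐ[μ] U k) (hUm : ∀ k < N, Measurable (U k))
    (htail : ∀ x, x₀ ≤ x → μ {ω | x < ∑ k ∈ Finset.range N, U k ω} ≤
      ENNReal.ofReal (c₁ * Real.exp (-c₂ * x)))
    (hz : 0 < z) (hz' : z ≤ c₂ * x₀) :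
    μ.real {ω | z * x₀ ≤ ∑ k ∈ Finset.range N, (μ[U k | ℱ k]) ω} ≤
      (1 + c₁) * Real.exp (1 - z / Real.exp 1) := by
  have he := Real.exp_pos 1
  rcases hp : ⌊z / Real.exp 1⌋₊ with _ | q
  · have h1 : z / Real.exp 1 < 1 := Nat.floor_eq_zero.1 hp
    have h2 : 1 ≤ Real.exp (1 - z / Real.exp 1) := Real.one_le_exp (by linarith)
    refine measureReal_le_one.trans ?_
    nlinarith
  have hple : ((q : ℝ) + 1) ≤ z / Real.exp 1 := by
    have := Nat.floor_le (a := z / Real.exp 1) (by positivity)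
    rw [hp] at this
    exact_mod_cast this
  have hlt : z / Real.exp 1 < (q : ℝ) + 1 + 1 := by
    have := Nat.lt_floor_add_one (z / Real.exp 1)
    rw [hp] at this
    exact_mod_cast this
  have hu0 : ∀ᵐ ω ∂μ, ∀ k < N, 0 ≤ U k ω :=
    ae_all_iff.2 fun k => Filter.eventually_imp_distrib_left.2 fun hk => hU0 k hk
  have hW0 : 0 ≤ᵐ[μ] fun ω => ∑ k ∈ Finset.range N, U k ω := hu0.mono fun ω hω =>
    Finset.sum_nonneg fun k hk => hω k (Finset.mem_range.1 hk)
  have hWm : Measurable fun ω => ∑ k ∈ Finset.range N, U k ω :=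
    Finset.measurable_fun_sum _ fun k hk => hUm k (Finset.mem_range.1 hk)
  obtain ⟨hWL, hWI⟩ := memLp_and_integral_pow_le_of_tail hc₁ hc₂ hx₀ hW0 hWm.aemeasurable htail q
  have hUL : ∀ k < N, MemLp (U k) (q + 1 : ℕ) μ := fun k hk => by
    refine hWL.mono (hUm k hk).aestronglyMeasurable ?_
    filter_upwards [hu0, hW0] with ω hω hω'
    rw [Real.norm_of_nonneg (hω k hk), Real.norm_of_nonneg hω']
    exact Finset.single_le_sum (f := fun k => U k ω) (fun i hi => hω i (Finset.mem_range.1 hi))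
      (Finset.mem_range.2 hk)
  obtain ⟨hVi, hVI⟩ := integral_sum_condExp_pow_le ℱ hU0 hUL
  have hv0 : ∀ᵐ ω ∂μ, ∀ k < N, 0 ≤ (μ[U k | ℱ k]) ω :=
    ae_all_iff.2 fun k => Filter.eventually_imp_distrib_left.2 fun hk => condExp_nonneg (hU0 k hk)
  have hmarkov := mul_meas_ge_le_integral_of_nonneg (hv0.mono fun ω hω => pow_nonneg
    (Finset.sum_nonneg fun k hk => hω k (Finset.mem_range.1 hk)) (q + 1)) hVi ((z * x₀) ^ (q + 1))
  have hzx : 0 < z * x₀ := by positivity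
  have hsub : μ.real {ω | z * x₀ ≤ ∑ k ∈ Finset.range N, (μ[U k | ℱ k]) ω} ≤
      μ.real {ω | (z * x₀) ^ (q + 1) ≤
        (∑ k ∈ Finset.range N, (μ[U k | ℱ k]) ω) ^ (q + 1)} :=
    measureReal_mono fun ω hω => pow_le_pow_left₀ hzx.le hω _
  have hpz : ((q : ℝ) + 1) * Real.exp 1 ≤ z := (le_div_iff₀ he).1 hple
  have hpz' : (q : ℝ) + 1 ≤ z :=
    (le_mul_of_one_le_right (by positivity) (Real.one_le_exp zero_le_one)).trans hpz
  have hfact : ((q + 1).factorial : ℝ) / c₂ ^ (q + 1) ≤ x₀ ^ (q + 1) := by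
    rw [div_le_iff₀ (by positivity), ← mul_pow]
    calc ((q + 1).factorial : ℝ) ≤ ((q + 1 : ℕ) : ℝ) ^ (q + 1) := by
          exact_mod_cast Nat.factorial_le_pow (q + 1)
      _ ≤ (x₀ * c₂) ^ (q + 1) := by
          refine pow_le_pow_left₀ (by positivity) ?_ _
          push_cast
          linarith
  have hmom : (z * x₀) ^ (q + 1) *
      μ.real {ω | z * x₀ ≤ ∑ k ∈ Finset.range N, (μ[U k | ℱ k]) ω} ≤
      (z * x₀) ^ (q + 1) * ((1 + c₁) * (Real.exp 1 ^ (q + 1))⁻¹) := by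
    calc _ ≤ _ := mul_le_mul_of_nonneg_left hsub (by positivity)
      _ ≤ _ := hmarkov
      _ ≤ _ := hVI
      _ ≤ ((q : ℝ) + 1) ^ (q + 1) * (x₀ ^ (q + 1) + c₁ * x₀ ^ (q + 1)) := by
          refine mul_le_mul_of_nonneg_left (hWI.trans ?_) (by positivity)
          gcongr
      _ ≤ (z / Real.exp 1) ^ (q + 1) * (x₀ ^ (q + 1) + c₁ * x₀ ^ (q + 1)) := by
          gcongr
      _ = _ := by
          rw [div_pow, mul_pow]
          ring
  refine (le_of_mul_le_mul_left hmom (by positivity)).trans ?_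
  rw [← Real.exp_nat_mul, ← Real.exp_neg]
  gcongr
  push_cast
  linarith

end

/-- Kesten's concentration inequality for martingales with bounded increments
(method of bounded increments). There exist universal constants `c₃, c₄ > 0`
(independent of everything else) such that: for any probability space, any `N`,
any filtration `ℱ`, any martingale `M` with increments `Δₖ = Mₖ - Mₖ₋₁` satisfying
`|Δₖ| ≤ c₀` and `𝔼(Δₖ² ∣ ℱₖ₋₁) ≤ 𝔼(Uₖ ∣ ℱₖ₋₁)` for nonnegative `ℱ_N`-measurable `Uₖ`,
and such that `ℙ(∑ₖ Uₖ > x) ≤ c₁ e^{-c₂ x}` for `x ≥ x₀ ≥ e² c₀²`, one has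
`ℙ(M_N - M₀ ≥ x) ≤ c₃ (1 + c₁ + c₁/(c₂ x₀)) e^{-c₄ x/√x₀}` for `0 < x ≤ c₂ x₀^{3/2}`. -/
theorem kesten_martingale_concentration :
    ∃ c₃ c₄ : ℝ, 0 < c₃ ∧ 0 < c₄ ∧
      ∀ (Ω : Type) (m0 : MeasurableSpace Ω) (μ : Measure Ω),
        IsProbabilityMeasure μ →
      ∀ (N : ℕ) (ℱ : Filtration ℕ m0) (M U : ℕ → Ω → ℝ) (c₀ c₁ c₂ x₀ : ℝ),
        0 < c₀ → 0 < c₁ → 0 < c₂ → Real.exp 2 * c₀ ^ 2 ≤ x₀ →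
        Martingale M ℱ μ →
        (∀ k, 1 ≤ k → k ≤ N → ∀ᵐ ω ∂μ, 0 ≤ U k ω) →
        (∀ k, 1 ≤ k → k ≤ N → Measurable[ℱ N] (U k)) →
        (∀ k, 1 ≤ k → k ≤ N → ∀ᵐ ω ∂μ, |M k ω - M (k - 1) ω| ≤ c₀) →
        (∀ k, 1 ≤ k → k ≤ N →
          μ[fun ω => (M k ω - M (k - 1) ω) ^ 2 | ℱ (k - 1)] ≤ᵐ[μ] μ[U k | ℱ (k - 1)]) →
        (∀ x : ℝ, x₀ ≤ x →
          μ {ω | x < ∑ k ∈ Finset.Icc 1 N, U k ω} ≤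
            ENNReal.ofReal (c₁ * Real.exp (-c₂ * x))) →
        ∀ x : ℝ, 0 < x → x ≤ c₂ * x₀ ^ ((3 : ℝ) / 2) →
          μ {ω | x ≤ M N ω - M 0 ω} ≤
            ENNReal.ofReal
              (c₃ * (1 + c₁ + c₁ / (c₂ * x₀)) * Real.exp (-c₄ * x / Real.sqrt x₀)) := by
  refine ⟨4, 1 / 4, by norm_num, by norm_num, ?_⟩
  intro Ω m0 μ hμ N ℱ M U c₀ c₁ c₂ x₀ hc₀ hc₁ hc₂ hx₀ hM hU0 hUm hb hcond htail x hx hx'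
  have hx₀pos : 0 < x₀ := lt_of_lt_of_le (by positivity) hx₀
  set s := Real.sqrt x₀
  have hspos : 0 < s := Real.sqrt_pos.2 hx₀pos
  have hss : s * s = x₀ := Real.mul_self_sqrt hx₀pos.le
  have hcs : c₀ ≤ s := Real.le_sqrt_of_sq_le
    ((le_mul_of_one_le_left (sq_nonneg _) (Real.one_le_exp (by norm_num))).trans hx₀)
  obtain ⟨z, rfl⟩ : ∃ z, x = z * s := ⟨x / s, by field_simp⟩
  have hz : 0 < z := pos_of_mul_pos_left hx hspos.le
  have hzc : z ≤ c₂ * x₀ := by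
    rw [show (3 : ℝ) / 2 = 1 + 1 / 2 by norm_num, Real.rpow_add hx₀pos, Real.rpow_one,
      ← Real.sqrt_eq_rpow, ← mul_assoc] at hx'
    exact le_of_mul_le_mul_right hx' hspos
  set v : ℕ → Ω → ℝ := fun k => μ[U (k + 1) | ℱ k]
  have hsum : ∀ ω, ∑ k ∈ Finset.range N, U (k + 1) ω = ∑ k ∈ Finset.Icc 1 N, U k ω := fun ω => by
    rw [Finset.range_eq_Ico, Finset.sum_Ico_add' (fun k => U k ω) 0 N 1]
    rfl
  have hU0' : ∀ k < N, 0 ≤ᵐ[μ] U (k + 1) := fun k hk => hU0 (k + 1) (Nat.le_add_left 1 k) hk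
  have hVtail := measureReal_sum_condExp_le ℱ (U := fun k => U (k + 1)) hc₁ hc₂ hx₀pos hU0'
    (fun k hk => (hUm (k + 1) (Nat.le_add_left 1 k) hk).mono (ℱ.le N) le_rfl)
    (by simpa only [hsum] using htail) hz hzc
  obtain ⟨hZi, hZ1⟩ := integrable_exp_and_integral_exp_le_one (v := v) (l := 1 / (2 * s)) hM
    (fun k hk => hb (k + 1) (Nat.le_add_left 1 k) hk) (fun k => stronglyMeasurable_condExp)
    (fun k hk => condExp_nonneg (hU0' k hk))
    (fun k hk => hcond (k + 1) (Nat.le_add_left 1 k) hk) (by positivity)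
    (by rw [one_div_mul_eq_div, div_le_one (by positivity)]; linarith) (le_refl N)
  have hmarkov := (mul_meas_ge_le_integral_of_nonneg (ae_of_all _ fun ω => (Real.exp_pos _).le)
    hZi (Real.exp (z / 4))).trans hZ1
  have hsub : {ω | z * s ≤ M N ω - M 0 ω} ⊆
      {ω | Real.exp (z / 4) ≤ Real.exp (1 / (2 * s) * (M N ω - M 0 ω) -
        (1 / (2 * s)) ^ 2 * ∑ k ∈ Finset.range N, v k ω)} ∪
      {ω | z * x₀ ≤ ∑ k ∈ Finset.range N, v k ω} := by
    intro ω hω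
    rcases le_total (z * x₀) (∑ k ∈ Finset.range N, v k ω) with h | h
    · exact Or.inr h
    · refine Or.inl (Real.exp_le_exp.2 ?_)
      have h1 : 1 / (2 * s) * (z * s) ≤ 1 / (2 * s) * (M N ω - M 0 ω) :=
        mul_le_mul_of_nonneg_left hω (by positivity)
      have h2 := mul_le_mul_of_nonneg_left h (sq_nonneg (1 / (2 * s)))
      have e1 : 1 / (2 * s) * (z * s) = z / 2 := by field_simp
      have e2 : (1 / (2 * s)) ^ 2 * (z * x₀) = z / 4 := by
        rw [← hss]
        field_simp
        norm_num
      linarith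
  have hfin := (measureReal_mono (μ := μ) hsub).trans (measureReal_union_le _ _)
  have hA : μ.real {ω | Real.exp (z / 4) ≤ Real.exp (1 / (2 * s) * (M N ω - M 0 ω) -
      (1 / (2 * s)) ^ 2 * ∑ k ∈ Finset.range N, v k ω)} ≤ Real.exp (-(z / 4)) := by
    rw [Real.exp_neg, ← one_div, le_div_iff₀' (Real.exp_pos _)]
    exact hmarkov
  rw [← ofReal_measureReal]
  refine ENNReal.ofReal_le_ofReal (hfin.trans ((add_le_add hA hVtail).trans ?_))
  have hexp : Real.exp (1 - z / Real.exp 1) ≤ 3 * Real.exp (-(z / 4)) := by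
    rw [sub_eq_add_neg, Real.exp_add]
    have h3 : Real.exp 1 ≤ 3 := Real.exp_one_lt_three.le
    have h4 : z / 4 ≤ z / Real.exp 1 := by gcongr; linarith
    gcongr
  have e : -(1 / 4) * (z * s) / s = -(z / 4) := by field_simp
  rw [e]
  have h5 : 0 ≤ c₁ / (c₂ * x₀) := by positivity
  have h6 := Real.exp_pos (-(z / 4))
  have h7 := mul_le_mul_of_nonneg_left hexp (by positivity : 0 ≤ 1 + c₁)
  nlinarith [mul_nonneg h5 h6.le, mul_nonneg hc₁.le h6.le]
end

section
/- Let $g : \{1, 2, 3, \dots\} \to \mathbb{R}$ and $C \ge 0$ be such that $g(2n) \le 2 g(n) + C (\log n)^2 \sqrt{n}$ for all integers $n \ge 2$, and suppose $\lim_{n \to \infty} g(n)/n = \gamma$ for some real $\gamma$. Then there exists a constant $b > 0$ such that $g(n) \ge \gamma n - b (\log n)^2 \sqrt{n}$ for all integers $n \ge 2$. -/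
/-- A nonnegative correction `φ` that absorbs the error of approximate doubling bounds the limit
of `g n / n` along dyadic scales. -/
theorem mul_le_add_of_doubling {g φ : ℕ → ℝ} {γ : ℝ}
    (hφ : ∀ n, 0 ≤ φ n)
    (hdouble : ∀ n : ℕ, 2 ≤ n → g (2 * n) + φ (2 * n) ≤ 2 * (g n + φ n))
    (hlim : Filter.Tendsto (fun n : ℕ => g n / n) Filter.atTop (nhds γ))
    {n : ℕ} (hn : 2 ≤ n) : γ * n ≤ g n + φ n := by
  have hiter : ∀ k : ℕ, g (2 ^ k * n) + φ (2 ^ k * n) ≤ 2 ^ k * (g n + φ n) := by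
    intro k
    induction k with
    | zero => simp
    | succ k ih =>
      have h := hdouble (2 ^ k * n) (hn.trans (Nat.le_mul_of_pos_left n (by positivity)))
      rw [← mul_assoc, ← pow_succ'] at h
      rw [pow_succ' (2 : ℝ)]
      linarith
  have hn0 : (0 : ℝ) < n := by exact_mod_cast (by omega : 0 < n)
  have htop : Filter.Tendsto (fun k : ℕ => 2 ^ k * n) Filter.atTop Filter.atTop :=
    (tendsto_pow_atTop_atTop_of_one_lt one_lt_two).atTop_mul_const' (by omega)
  rw [← le_div_iff₀ hn0]
  refine le_of_tendsto' (hlim.comp htop) fun k => ?_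
  have hk := hiter k
  have hk' := hφ (2 ^ k * n)
  simp only [Function.comp_apply]
  push_cast
  rw [div_le_div_iff₀ (by positivity) hn0]
  nlinarith

/-- The function `(log n + 6)² √n` grows by a factor less than `2` under doubling, uniformly
in `n`. -/
theorem log_add_sq_mul_sqrt_two_mul_le {n : ℕ} (hn : 2 ≤ n) :
    (Real.log (2 * n) + 6) ^ 2 * √(2 * n) ≤ 19 / 10 * ((Real.log n + 6) ^ 2 * √n) := by
  have hlog : 0 ≤ Real.log n := Real.log_natCast_nonneg n
  have hlog2 := Real.log_two_lt_d9
  have hlog2pos : 0 < Real.log 2 := Real.log_pos one_lt_two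
  have hsqrt2 : √2 ≤ 3 / 2 := Real.sqrt_le_iff.2 ⟨by norm_num, by norm_num⟩
  have hn0 : (n : ℝ) ≠ 0 := by exact_mod_cast (by omega : n ≠ 0)
  rw [Real.log_mul two_ne_zero hn0, Real.sqrt_mul zero_le_two]
  have hsq : (Real.log 2 + Real.log n + 6) ^ 2 ≤ (9 / 8 * (Real.log n + 6)) ^ 2 :=
    pow_le_pow_left₀ (by positivity) (by linarith) 2
  calc (Real.log 2 + Real.log n + 6) ^ 2 * (√2 * √n)
      ≤ (9 / 8 * (Real.log n + 6)) ^ 2 * (3 / 2 * √n) := by gcongr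
    _ ≤ 19 / 10 * ((Real.log n + 6) ^ 2 * √n) := by
      have : 0 ≤ (Real.log n + 6) ^ 2 * √n := by positivity
      nlinarith


/-- Deterministic doubling lemma (Howard–Newman style): if
`g(2n) ≤ 2 g(n) + C (log n)² √n` for all `n ≥ 2` and `g(n)/n → γ`, then there is a
constant `b > 0` with `g(n) ≥ γ n - b (log n)² √n` for all `n ≥ 2`. -/
theorem doubling_lemma (g : ℕ → ℝ) (C γ : ℝ) (hC : 0 ≤ C)
    (hsub : ∀ n : ℕ, 2 ≤ n →
      g (2 * n) ≤ 2 * g n + C * Real.log n ^ 2 * Real.sqrt n)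
    (hlim : Filter.Tendsto (fun n : ℕ => g n / n) Filter.atTop (nhds γ)) :
    ∃ b : ℝ, 0 < b ∧ ∀ n : ℕ, 2 ≤ n →
      γ * n - b * Real.log n ^ 2 * Real.sqrt n ≤ g n := by
  refine ⟨1000 * C + 1, by positivity, fun n hn => ?_⟩
  have hmain := mul_le_add_of_doubling
    (φ := fun n => 10 * C * ((Real.log n + 6) ^ 2 * √n)) (fun n => by positivity)
    (fun m hm => by
      have hgrow := mul_le_mul_of_nonneg_left (log_add_sq_mul_sqrt_two_mul_le hm)
        (by positivity : 0 ≤ 10 * C)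
      have hlog : 0 ≤ Real.log m := Real.log_natCast_nonneg m
      have herr : C * Real.log m ^ 2 * √m ≤ C * (Real.log m + 6) ^ 2 * √m := by
        gcongr
        linarith
      have hm' := hsub m hm
      push_cast
      linarith) hlim hn
  have hlog : Real.log 2 ≤ Real.log n :=
    Real.log_le_log two_pos (by exact_mod_cast hn)
  have hlog2 := Real.log_two_gt_d9
  have hsq : (Real.log n + 6) ^ 2 ≤ (10 * Real.log n) ^ 2 :=
    pow_le_pow_left₀ (by linarith) (by linarith) 2
  have hφ : 10 * C * ((Real.log n + 6) ^ 2 * √n) ≤ 10 * C * ((10 * Real.log n) ^ 2 * √n) := by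
    gcongr
  have hpos : 0 ≤ Real.log n ^ 2 * √n := by positivity
  linarith
end

section
/- Let $\nu : \mathbb{R} \to \mathbb{R}$ be a nondecreasing function and let $c \in \mathbb{R}$ be such that $\lim_{x \to +\infty} \nu(x)/x = c$ and $\lim_{x \to -\infty} \nu(x)/x = c$. Then $\limsup_{d \to \infty} \sup_{z \in [-4d, 4d]} \frac{\nu(z+d) - \nu(z-d)}{2d} \le c$ and $\liminf_{d \to \infty} \inf_{z \in [-4d, 4d]} \frac{\nu(z+d) - \nu(z-d)}{2d} \ge c$. -/
/-- A monotone function with asymptotic slope `c` at both ends differs from `c * x` by at most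
`ε * |x|` plus a constant. -/
theorem Monotone.exists_abs_sub_mul_le {ν : ℝ → ℝ} (hmono : Monotone ν) {c : ℝ}
    (htop : Filter.Tendsto (fun x : ℝ => ν x / x) Filter.atTop (nhds c))
    (hbot : Filter.Tendsto (fun x : ℝ => ν x / x) Filter.atBot (nhds c))
    {ε : ℝ} (hε : 0 < ε) : ∃ K : ℝ, ∀ x : ℝ, |ν x - c * x| ≤ ε * |x| + K := by
  obtain ⟨a, ha⟩ := Filter.eventually_atTop.1 (htop.eventually (Metric.closedBall_mem_nhds c hε))
  obtain ⟨b, hb⟩ := Filter.eventually_atBot.1 (hbot.eventually (Metric.closedBall_mem_nhds c hε))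
  have slope {x : ℝ} (hx : x ≠ 0) (h : |ν x / x - c| ≤ ε) : |ν x - c * x| ≤ ε * |x| := by
    have hνx : ν x - c * x = (ν x / x - c) * x := by field_simp
    rw [hνx, abs_mul]
    gcongr
  obtain ⟨M, haM, hbM, hM⟩ : ∃ M : ℝ, a ≤ M ∧ -b ≤ M ∧ 1 ≤ M :=
    ⟨max a (max (-b) 1), by simp, by simp, by simp⟩
  have hK : 0 ≤ |ν M| + |ν (-M)| + |c| * M := by positivity
  refine ⟨|ν M| + |ν (-M)| + |c| * M, fun x => ?_⟩
  rcases le_total M x with hx | hx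
  · linarith [slope (by linarith : 0 < x).ne' (ha x (by linarith))]
  rcases le_total x (-M) with hx' | hx'
  · linarith [slope (by linarith : x < 0).ne (hb x (by linarith))]
  have hν : |ν x| ≤ |ν M| + |ν (-M)| :=
    abs_le.2 ⟨by linarith [hmono hx', neg_abs_le (ν (-M)), abs_nonneg (ν M)],
      by linarith [hmono hx, le_abs_self (ν M), abs_nonneg (ν (-M))]⟩
  have hcx : |c * x| ≤ |c| * M := by
    rw [abs_mul]
    exact mul_le_mul_of_nonneg_left (abs_le.2 ⟨hx', hx⟩) (abs_nonneg c)
  have hεx : 0 ≤ ε * |x| := by positivity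
  linarith [abs_sub (ν x) (c * x)]

/-- The average densities of a monotone function with asymptotic slope `c` at both ends converge
to `c`, uniformly over midpoints in `[-4d, 4d]`. -/
theorem Monotone.eventually_abs_density_sub_le {ν : ℝ → ℝ} (hmono : Monotone ν) {c : ℝ}
    (htop : Filter.Tendsto (fun x : ℝ => ν x / x) Filter.atTop (nhds c))
    (hbot : Filter.Tendsto (fun x : ℝ => ν x / x) Filter.atBot (nhds c))
    {ε : ℝ} (hε : 0 < ε) :
    ∀ᶠ d : ℝ in Filter.atTop, 0 < d ∧ ∀ z : Set.Icc (-(4 * d)) (4 * d),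
      |(ν ((z : ℝ) + d) - ν ((z : ℝ) - d)) / (2 * d) - c| ≤ ε := by
  obtain ⟨K, hK⟩ := hmono.exists_abs_sub_mul_le htop hbot (by positivity : 0 < ε / 10)
  filter_upwards [Filter.eventually_gt_atTop 0, Filter.eventually_ge_atTop (2 * K / ε)]
    with d hd hdK
  refine ⟨hd, fun z => ?_⟩
  obtain ⟨z, hz₁, hz₂⟩ := z
  rw [div_le_iff₀ hε] at hdK
  have hp : |z + d| ≤ 5 * d := abs_le.2 ⟨by linarith, by linarith⟩
  have hm : |z - d| ≤ 5 * d := abs_le.2 ⟨by linarith, by linarith⟩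
  have hp' := mul_le_mul_of_nonneg_left hp (by positivity : 0 ≤ ε / 10)
  have hm' := mul_le_mul_of_nonneg_left hm (by positivity : 0 ≤ ε / 10)
  have key : (ν (z + d) - ν (z - d)) / (2 * d) - c =
      ((ν (z + d) - c * (z + d)) - (ν (z - d) - c * (z - d))) / (2 * d) := by
    field_simp
    ring
  rw [key, abs_div, abs_of_pos (by positivity : 0 < 2 * d), div_le_iff₀ (by positivity)]
  linarith [abs_sub (ν (z + d) - c * (z + d)) (ν (z - d) - c * (z - d)), hK (z + d), hK (z - d)]

/-- If a nondecreasing profile `ν` satisfies `ν(x)/x → c` as `x → ±∞`, then the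
average densities `(ν(z+d) - ν(z-d))/(2d)` over midpoints `z ∈ [-4d, 4d]` satisfy
`limsup_{d→∞} sup_z ≤ c` and `liminf_{d→∞} inf_z ≥ c`. -/
theorem density_limits (ν : ℝ → ℝ) (hmono : Monotone ν) (c : ℝ)
    (htop : Filter.Tendsto (fun x : ℝ => ν x / x) Filter.atTop (nhds c))
    (hbot : Filter.Tendsto (fun x : ℝ => ν x / x) Filter.atBot (nhds c)) :
    Filter.limsup
        (fun d : ℝ => ⨆ z : Set.Icc (-(4 * d)) (4 * d),
          (ν ((z : ℝ) + d) - ν ((z : ℝ) - d)) / (2 * d)) Filter.atTop ≤ c ∧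
    c ≤ Filter.liminf
        (fun d : ℝ => ⨅ z : Set.Icc (-(4 * d)) (4 * d),
          (ν ((z : ℝ) + d) - ν ((z : ℝ) - d)) / (2 * d)) Filter.atTop := by
  have close {ε : ℝ} (hε : 0 < ε) := hmono.eventually_abs_density_sub_le htop hbot hε
  constructor
  · refine (Filter.Tendsto.limsup_eq (Metric.tendsto_nhds.2 fun ε hε => ?_)).le
    filter_upwards [close (half_pos hε)] with d ⟨hd, h⟩
    let z₀ : Set.Icc (-(4 * d)) (4 * d) := ⟨0, by linarith, by linarith⟩
    have : Nonempty (Set.Icc (-(4 * d)) (4 * d)) := ⟨z₀⟩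
    have upper (z : Set.Icc (-(4 * d)) (4 * d)) :
        (ν ((z : ℝ) + d) - ν ((z : ℝ) - d)) / (2 * d) ≤ c + ε / 2 := by
      linarith [(abs_le.1 (h z)).2]
    have hsup := ciSup_le upper
    have hz₀ := le_ciSup ⟨c + ε / 2, Set.forall_mem_range.2 upper⟩ z₀
    rw [Real.dist_eq, abs_lt]
    constructor <;> linarith [(abs_le.1 (h z₀)).1]
  · refine (Filter.Tendsto.liminf_eq (Metric.tendsto_nhds.2 fun ε hε => ?_)).ge
    filter_upwards [close (half_pos hε)] with d ⟨hd, h⟩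
    let z₀ : Set.Icc (-(4 * d)) (4 * d) := ⟨0, by linarith, by linarith⟩
    have : Nonempty (Set.Icc (-(4 * d)) (4 * d)) := ⟨z₀⟩
    have lower (z : Set.Icc (-(4 * d)) (4 * d)) :
        c - ε / 2 ≤ (ν ((z : ℝ) + d) - ν ((z : ℝ) - d)) / (2 * d) := by
      linarith [(abs_le.1 (h z)).1]
    have hinf := le_ciInf lower
    have hz₀ := ciInf_le ⟨c - ε / 2, Set.forall_mem_range.2 lower⟩ z₀
    rw [Real.dist_eq, abs_lt]
    constructor <;> linarith [(abs_le.1 (h z₀)).2]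
end
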